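/- Let 0 < σ < 1 and α, β ≥ −1/2. Define the weights w(θ) = (sin(θ/2))^{(2α+1)(1−q/2)} (cos(θ/2))^{(2β+1)(1−q/2)} and v(θ) = (sin(θ/2))^{(2α+1)(1−p/2)} (cos(θ/2))^{(2β+1)(1−p/2)} on (0,π). Suppose the exponents p, q satisfy max{(2α+2)/(α+3/2), (2β+2)/(β+3/2)} < p ≤ q < min{(2α+2)/(α+1/2), (2β+2)/(β+1/2)} and 1/q ≥ 1/p − min{σ/(2α+2), σ/(2β+2)}. Then there exists a constant C, depending only on σ, α, β, p and q, such that for all nonnegative measurable g on (0,π): (∫_0^π (I_σ g(θ))^q w(θ) dθ)^{1/q} ≤ C (∫_0^π g(θ)^p v(θ) dθ)^{1/p}. -/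

import Mathlib

open MeasureTheory Real Set

/-- The fractional integral `I_σ g(θ) = ∫_0^π g(φ)/|θ-φ|^{1-σ} dφ` of a nonnegative
function on `(0,π)`, with values in `[0,∞]`. -/
noncomputable def fracIntegral (σ : ℝ) (g : ℝ → ℝ) (θ : ℝ) : ENNReal :=
  ∫⁻ φ in Ioo (0:ℝ) π, ENNReal.ofReal (g φ) * ENNReal.ofReal |θ - φ| ^ (σ - 1)

theorem schur_young {μ : Measure ℝ} [SFinite μ] (k : ℝ → ℝ → ENNReal)
    (hk : Measurable (Function.uncurry k)) (f : ℝ → ENNReal) (hf : Measurable f)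
    (p q r : ℝ) (hp : 1 < p) (hpq : p ≤ q) (hr0 : 0 < r) (hr : 1 / r = 1 - 1 / p + 1 / q)
    (A : ENNReal)
    (h1 : ∀ᵐ x ∂μ, ∫⁻ y, k x y ^ r ∂μ ≤ A) (h2 : ∀ᵐ y ∂μ, ∫⁻ x, k x y ^ r ∂μ ≤ A) :
    (∫⁻ x, (∫⁻ y, k x y * f y ∂μ) ^ q ∂μ) ^ (1 / q) ≤
      A ^ (1 / r) * (∫⁻ y, f y ^ p ∂μ) ^ (1 / p) := by
  have hp0 : 0 < p := by linarith
  have hq0 : 0 < q := by linarith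
  have e2 : 0 ≤ 1 - 1 / p := by
    rw [sub_nonneg, div_le_one hp0]; exact hp.le
  have e3 : 0 ≤ 1 / p - 1 / q := by
    rw [sub_nonneg]; exact one_div_le_one_div_of_le hp0 hpq
  have e1 : 0 ≤ 1 / q := by positivity
  set I := ∫⁻ y, f y ^ p ∂μ with hI
  have key : ∀ᵐ x ∂μ, (∫⁻ y, k x y * f y ∂μ) ^ q ≤
      (∫⁻ y, k x y ^ r * f y ^ p ∂μ) * (A ^ ((1 - 1 / p) * q) * I ^ ((1 / p - 1 / q) * q)) := by
    filter_upwards [h1] with x hx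
    have hkx : Measurable (k x) := hk.of_uncurry_left
    have H := ENNReal.lintegral_prod_norm_pow_le (μ := μ) (Finset.univ : Finset (Fin 3))
      (f := ![fun y => k x y ^ r * f y ^ p, fun y => k x y ^ r, fun y => f y ^ p])
      (by
        intro i _
        fin_cases i
        · exact ((hkx.pow_const _).mul (hf.pow_const _)).aemeasurable
        · exact (hkx.pow_const _).aemeasurable
        · exact (hf.pow_const _).aemeasurable)
      (p := ![1 / q, 1 - 1 / p, 1 / p - 1 / q])
      (by simp [Fin.sum_univ_three]; ring)
      (by
        intro i _
        fin_cases i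
        · exact e1
        · exact e2
        · exact e3)
    simp only [Fin.prod_univ_three, Matrix.cons_val_zero, Matrix.cons_val_one,
      Matrix.cons_val] at H
    have eq1 : ∀ y, (k x y ^ r * f y ^ p) ^ (1 / q) * (k x y ^ r) ^ (1 - 1 / p) *
        (f y ^ p) ^ (1 / p - 1 / q) = k x y * f y := by
      intro y
      rw [ENNReal.mul_rpow_of_nonneg _ _ e1]
      have a1 : (k x y ^ r) ^ (1 / q) * (k x y ^ r) ^ (1 - 1 / p) = k x y := by
        rw [← ENNReal.rpow_add_of_nonneg _ _ e1 e2, ← ENNReal.rpow_mul]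
        have : r * (1 / q + (1 - 1 / p)) = 1 := by
          rw [show 1 / q + (1 - 1 / p) = 1 / r by rw [hr]; ring]; field_simp
        rw [this, ENNReal.rpow_one]
      have a2 : (f y ^ p) ^ (1 / q) * (f y ^ p) ^ (1 / p - 1 / q) = f y := by
        rw [← ENNReal.rpow_add_of_nonneg _ _ e1 e3, ← ENNReal.rpow_mul]
        have : p * (1 / q + (1 / p - 1 / q)) = 1 := by field_simp; ring
        rw [this, ENNReal.rpow_one]
      calc _ = ((k x y ^ r) ^ (1 / q) * (k x y ^ r) ^ (1 - 1 / p)) *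
            ((f y ^ p) ^ (1 / q) * (f y ^ p) ^ (1 / p - 1 / q)) := by ring
        _ = _ := by rw [a1, a2]
    simp only [eq1] at H
    calc _ ≤ _ := ENNReal.rpow_le_rpow H hq0.le
      _ = (∫⁻ y, k x y ^ r * f y ^ p ∂μ) * ((∫⁻ y, k x y ^ r ∂μ) ^ ((1 - 1 / p) * q) *
            I ^ ((1 / p - 1 / q) * q)) := by
          rw [ENNReal.mul_rpow_of_nonneg _ _ hq0.le, ENNReal.mul_rpow_of_nonneg _ _ hq0.le,
            ← ENNReal.rpow_mul, ← ENNReal.rpow_mul, ← ENNReal.rpow_mul,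
            one_div_mul_cancel hq0.ne', ENNReal.rpow_one, mul_assoc]
      _ ≤ _ := by gcongr
  have hm : Measurable (Function.uncurry fun x y => k x y ^ r * f y ^ p) :=
    (hk.pow_const _).mul ((hf.comp measurable_snd).pow_const _)
  have main : ∫⁻ x, (∫⁻ y, k x y * f y ∂μ) ^ q ∂μ ≤ A ^ (q / r) * I ^ (q / p) := by
    calc _ ≤ _ := lintegral_mono_ae key
      _ = (∫⁻ x, ∫⁻ y, k x y ^ r * f y ^ p ∂μ ∂μ) *
          (A ^ ((1 - 1 / p) * q) * I ^ ((1 / p - 1 / q) * q)) := by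
          exact lintegral_mul_const _ hm.lintegral_prod_right'
      _ ≤ (A * I) * (A ^ ((1 - 1 / p) * q) * I ^ ((1 / p - 1 / q) * q)) := by
          gcongr
          rw [lintegral_lintegral_swap hm.aemeasurable, hI,
            ← lintegral_const_mul _ (hf.pow_const _)]
          refine lintegral_mono_ae ?_
          filter_upwards [h2] with y hy
          rw [lintegral_mul_const _ (hk.of_uncurry_right.pow_const _)]
          gcongr
      _ = (A ^ (1:ℝ) * A ^ ((1 - 1 / p) * q)) * (I ^ (1:ℝ) * I ^ ((1 / p - 1 / q) * q)) := by
          rw [ENNReal.rpow_one, ENNReal.rpow_one]; ring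
      _ = _ := by
          rw [← ENNReal.rpow_add_of_nonneg _ _ zero_le_one (mul_nonneg e2 hq0.le),
            ← ENNReal.rpow_add_of_nonneg _ _ zero_le_one (mul_nonneg e3 hq0.le)]
          congr 2
          · rw [div_eq_mul_one_div q r, hr]; field_simp; ring
          · field_simp; ring
  calc _ ≤ _ := ENNReal.rpow_le_rpow main e1
    _ = _ := by
      rw [ENNReal.mul_rpow_of_nonneg _ _ e1, ← ENNReal.rpow_mul, ← ENNReal.rpow_mul]
      congr 2 <;> field_simp

theorem lint_pow_Ioo {e : ℝ} (he : -1 < e) (c : ℝ) (hc : 0 < c) :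
    ∫⁻ t in Ioc (0:ℝ) c, ENNReal.ofReal t ^ e < ⊤ := by
  have h := (intervalIntegrable_iff_integrableOn_Ioc_of_le hc.le).1
    (intervalIntegral.intervalIntegrable_rpow' (a := 0) (b := c) he)
  refine lt_of_eq_of_lt ?_ h.lintegral_lt_top
  refine setLIntegral_congr_fun measurableSet_Ioc fun t ht => ?_
  exact ENNReal.ofReal_rpow_of_pos ht.1

theorem lint_pow_Ioi {e : ℝ} (he : e < -1) (c : ℝ) (hc : 0 < c) :
    ∫⁻ t in Ioi c, ENNReal.ofReal t ^ e < ⊤ := by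
  have h := integrableOn_Ioi_rpow_of_lt he hc
  refine lt_of_eq_of_lt ?_ h.lintegral_lt_top
  refine setLIntegral_congr_fun measurableSet_Ioi fun t ht => ?_
  exact ENNReal.ofReal_rpow_of_pos (hc.trans ht)

theorem lint_abs {s : ℝ} (hs : s < 1) :
    ∫⁻ t in Ioc (1/2:ℝ) 2, ENNReal.ofReal |1 - t| ^ (-s) < ⊤ := by
  have h := lint_pow_Ioo (e := -s) (by linarith) 1 one_pos
  have sub : ∫⁻ t in Ioc (1/2:ℝ) 2, ENNReal.ofReal |1 - t| ^ (-s) ≤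
      ∫⁻ t in Icc (0:ℝ) 2, ENNReal.ofReal |1 - t| ^ (-s) :=
    lintegral_mono_set fun t ht => ⟨by linarith [ht.1], ht.2⟩
  refine sub.trans_lt ?_
  rw [← lintegral_indicator measurableSet_Icc, ← lintegral_sub_left_eq_self _ (1:ℝ),
    ]
  have : ∀ u : ℝ, (Icc (0:ℝ) 2).indicator (fun t => ENNReal.ofReal |1 - t| ^ (-s)) (1 - u) =
      (Icc (-1:ℝ) 1).indicator (fun t => ENNReal.ofReal |t| ^ (-s)) u := by
    intro u
    by_cases hu : u ∈ Icc (-1:ℝ) 1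
    · rw [indicator_of_mem hu, indicator_of_mem (by constructor <;> linarith [hu.1, hu.2])]
      simp
    · rw [indicator_of_notMem hu, indicator_of_notMem]
      intro h; exact hu ⟨by linarith [h.2], by linarith [h.1]⟩
  simp_rw [this]
  rw [lintegral_indicator measurableSet_Icc]
  have hpos : ∫⁻ t in Ioc (0:ℝ) 1, ENNReal.ofReal |t| ^ (-s) < ⊤ := by
    refine lt_of_eq_of_lt ?_ h
    refine setLIntegral_congr_fun measurableSet_Ioc fun t ht => ?_
    simp only [abs_of_pos ht.1]
  have hneg : ∫⁻ t in Ico (-1:ℝ) 0, ENNReal.ofReal |t| ^ (-s) < ⊤ := by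
    refine lt_of_eq_of_lt ?_ hpos
    rw [← lintegral_indicator measurableSet_Ico, ← lintegral_indicator measurableSet_Ioc,
      ← lintegral_neg_eq_self]
    congr 1
    ext t
    by_cases ht : t ∈ Ioc (0:ℝ) 1
    · rw [indicator_of_mem ht, indicator_of_mem (by constructor <;> linarith [ht.1, ht.2])]
      simp
    · rw [indicator_of_notMem ht, indicator_of_notMem]
      intro h; exact ht ⟨by linarith [h.2], by linarith [h.1]⟩
  have hz : ∫⁻ t in ({0}:Set ℝ), ENNReal.ofReal |t| ^ (-s) = 0 :=
    setLIntegral_measure_zero _ _ (by simp)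
  calc _ ≤ ∫⁻ t in (Ico (-1:ℝ) 0 ∪ {0}) ∪ Ioc (0:ℝ) 1, ENNReal.ofReal |t| ^ (-s) := by
        apply lintegral_mono_set
        intro t ht
        rcases lt_trichotomy t 0 with h | h | h
        · exact Or.inl (Or.inl ⟨ht.1, h⟩)
        · exact Or.inl (Or.inr h)
        · exact Or.inr ⟨h, ht.2⟩
    _ ≤ _ := lintegral_union_le _ _ _
    _ ≤ _ := add_le_add_left (lintegral_union_le _ _ _) _
    _ < ⊤ := by
      rw [hz, add_zero]; exact ENNReal.add_lt_top.2 ⟨hneg, hpos⟩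

theorem rpow_anti {a b : ENNReal} (h : a ≤ b) {e : ℝ} (he : e ≤ 0) : b ^ e ≤ a ^ e := by
  rw [← neg_neg e, ENNReal.rpow_neg, ENNReal.rpow_neg a, ENNReal.inv_le_inv]
  exact ENNReal.rpow_le_rpow h (by linarith)

theorem rpow_ne_top_of_pos {x e : ℝ} (hx : 0 < x) : ENNReal.ofReal x ^ e ≠ ⊤ := by
  rw [ENNReal.ofReal_rpow_of_pos hx]; exact ENNReal.ofReal_ne_top

theorem J_fin {A s : ℝ} (hA : 0 < A) (hAs : A < s) (hs : s < 1) :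
    ∫⁻ t in Ioi (0:ℝ), ENNReal.ofReal |1 - t| ^ (-s) * ENNReal.ofReal t ^ (A - 1) < ⊤ := by
  have h1 : ∫⁻ t in Ioc (0:ℝ) (1/2), ENNReal.ofReal |1 - t| ^ (-s) * ENNReal.ofReal t ^ (A - 1)
      < ⊤ := by
    calc _ ≤ ∫⁻ t in Ioc (0:ℝ) (1/2), ENNReal.ofReal (1/2) ^ (-s) * ENNReal.ofReal t ^ (A - 1) := by
          refine setLIntegral_mono' measurableSet_Ioc fun t ht => ?_
          gcongr ?_ * _
          refine rpow_anti (ENNReal.ofReal_le_ofReal ?_) (by linarith)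
          rw [abs_of_nonneg] <;> linarith [ht.2]
      _ = _ := lintegral_const_mul' _ _ (rpow_ne_top_of_pos (by norm_num))
      _ < ⊤ := ENNReal.mul_lt_top (rpow_ne_top_of_pos (by norm_num)).lt_top
          (lint_pow_Ioo (by linarith) _ (by norm_num))
  have h2 : ∫⁻ t in Ioc (1/2:ℝ) 2, ENNReal.ofReal |1 - t| ^ (-s) * ENNReal.ofReal t ^ (A - 1)
      < ⊤ := by
    calc _ ≤ ∫⁻ t in Ioc (1/2:ℝ) 2, ENNReal.ofReal |1 - t| ^ (-s) *
            ENNReal.ofReal (1/2) ^ (A - 1) := by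
          refine setLIntegral_mono' measurableSet_Ioc fun t ht => ?_
          gcongr _ * ?_
          exact rpow_anti (ENNReal.ofReal_le_ofReal ht.1.le) (by linarith)
      _ = _ := lintegral_mul_const' _ _ (rpow_ne_top_of_pos (by norm_num))
      _ < ⊤ := ENNReal.mul_lt_top (lint_abs hs) (rpow_ne_top_of_pos (by norm_num)).lt_top
  have h3 : ∫⁻ t in Ioi (2:ℝ), ENNReal.ofReal |1 - t| ^ (-s) * ENNReal.ofReal t ^ (A - 1)
      < ⊤ := by
    calc _ ≤ ∫⁻ t in Ioi (2:ℝ), ENNReal.ofReal (1/2) ^ (-s) * ENNReal.ofReal t ^ (A - 1 - s) := by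
          refine setLIntegral_mono' measurableSet_Ioi fun t ht => ?_
          have ht2 : (2:ℝ) < t := ht
          have : ENNReal.ofReal t ^ (A - 1 - s) =
              ENNReal.ofReal t ^ (-s) * ENNReal.ofReal t ^ (A - 1) := by
            rw [← ENNReal.rpow_add _ _ (by simp; linarith) ENNReal.ofReal_ne_top]
            congr 1; ring
          rw [this, ← mul_assoc, ← ENNReal.mul_rpow_of_ne_top ENNReal.ofReal_ne_top
            ENNReal.ofReal_ne_top, ← ENNReal.ofReal_mul (by norm_num)]
          gcongr ?_ * _
          refine rpow_anti (ENNReal.ofReal_le_ofReal ?_) (by linarith)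
          rw [abs_of_nonpos] <;> linarith
      _ = _ := lintegral_const_mul' _ _ (rpow_ne_top_of_pos (by norm_num))
      _ < ⊤ := ENNReal.mul_lt_top (rpow_ne_top_of_pos (by norm_num)).lt_top
          (lint_pow_Ioi (by linarith) _ (by norm_num))
  calc _ ≤ ∫⁻ t in (Ioc (0:ℝ) (1/2) ∪ Ioc (1/2:ℝ) 2) ∪ Ioi (2:ℝ),
          ENNReal.ofReal |1 - t| ^ (-s) * ENNReal.ofReal t ^ (A - 1) := by
        apply lintegral_mono_set
        intro t ht
        have ht0 : (0:ℝ) < t := ht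
        by_cases a : t ≤ 1/2
        · exact Or.inl (Or.inl ⟨ht, a⟩)
        by_cases b : t ≤ 2
        · exact Or.inl (Or.inr ⟨not_le.1 a, b⟩)
        · exact Or.inr (not_le.1 b)
    _ ≤ _ := lintegral_union_le _ _ _
    _ ≤ _ := add_le_add_left (lintegral_union_le _ _ _) _
    _ < ⊤ := ENNReal.add_lt_top.2 ⟨ENNReal.add_lt_top.2 ⟨h1, h2⟩, h3⟩

theorem J_scale {A s x : ℝ} (hx : 0 < x) :
    ENNReal.ofReal x ^ (s - A) *
      ∫⁻ y in Ioi (0:ℝ), ENNReal.ofReal |x - y| ^ (-s) * ENNReal.ofReal y ^ (A - 1) =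
    ∫⁻ t in Ioi (0:ℝ), ENNReal.ofReal |1 - t| ^ (-s) * ENNReal.ofReal t ^ (A - 1) := by
  have hE0 : ENNReal.ofReal x ≠ 0 := by simpa using hx
  have hEt : ENNReal.ofReal x ≠ ⊤ := ENNReal.ofReal_ne_top
  have hemb : MeasurableEmbedding (fun t : ℝ => x * t) :=
    (Homeomorph.mulLeft₀ x hx.ne').measurableEmbedding
  rw [← lintegral_indicator measurableSet_Ioi]
  nth_rewrite 1 [← Real.smul_map_volume_mul_left hx.ne']
  rw [lintegral_smul_measure,
    hemb.lintegral_map, abs_of_pos hx,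
    smul_eq_mul, ← mul_assoc, ← lintegral_indicator measurableSet_Ioi,
    ← lintegral_const_mul' _ _ (ENNReal.mul_ne_top (rpow_ne_top_of_pos hx) hEt)]
  congr 1
  ext t
  by_cases ht : 0 < t
  · rw [indicator_of_mem (by simpa using mul_pos hx ht), indicator_of_mem (by simpa using ht)]
    have : |x - x * t| = x * |1 - t| := by
      rw [show x - x * t = x * (1 - t) by ring, abs_mul, abs_of_pos hx]
    rw [this, ENNReal.ofReal_mul hx.le, ENNReal.ofReal_mul hx.le,
      ENNReal.mul_rpow_of_ne_top hEt ENNReal.ofReal_ne_top,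
      ENNReal.mul_rpow_of_ne_top hEt ENNReal.ofReal_ne_top]
    have : ENNReal.ofReal x ^ (s - A) * ENNReal.ofReal x * ENNReal.ofReal x ^ (-s) *
        ENNReal.ofReal x ^ (A - 1) = 1 := by
      nth_rewrite 2 [← ENNReal.rpow_one (ENNReal.ofReal x)]
      rw [← ENNReal.rpow_add _ _ hE0 hEt, ← ENNReal.rpow_add _ _ hE0 hEt,
        ← ENNReal.rpow_add _ _ hE0 hEt]
      rw [show s - A + 1 + -s + (A - 1) = 0 by ring, ENNReal.rpow_zero]
    calc _ = (ENNReal.ofReal x ^ (s - A) * ENNReal.ofReal x * ENNReal.ofReal x ^ (-s) *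
        ENNReal.ofReal x ^ (A - 1)) * (ENNReal.ofReal |1 - t| ^ (-s) * ENNReal.ofReal t ^ (A - 1)) := by
          ring
      _ = _ := by rw [this, one_mul]
  · rw [indicator_of_notMem (a := t) (by simpa using ht), indicator_of_notMem, mul_zero]
    simp only [mem_Ioi, not_lt]
    exact mul_nonpos_of_nonneg_of_nonpos hx.le (not_lt.1 ht)

theorem sin_half_pos {x : ℝ} (hx : x ∈ Ioo 0 π) : 0 < sin (x / 2) :=
  sin_pos_of_pos_of_lt_pi (by linarith [hx.1]) (by linarith [hx.1, hx.2])

theorem cos_half_pos {x : ℝ} (hx : x ∈ Ioo 0 π) : 0 < cos (x / 2) :=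
  cos_pos_of_mem_Ioo ⟨by linarith [hx.1, pi_pos], by linarith [hx.2]⟩

theorem half_sin {A0 A1 s : ℝ} (h0 : 0 < A0) (h1 : 0 < A1) (hs0 : 0 < s) (hs : s < 1)
    (hA : s ≤ A0 + A1) : ∃ C : ENNReal, C ≠ ⊤ ∧ ∀ x ∈ Ioo 0 π,
      ∫⁻ y in Ioo 0 π, ENNReal.ofReal (sin (x / 2)) ^ A0 * (ENNReal.ofReal |x - y| ^ (-s) *
        ENNReal.ofReal (sin (y / 2)) ^ (A1 - 1)) ≤ C := by
  obtain ⟨A, hA0, hAs, hA1, hA2⟩ : ∃ A, 0 < A ∧ A < s ∧ A ≤ A1 ∧ s - A ≤ A0 := by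
    have hsum : 0 < A0 + A1 := by linarith
    have hle : s / (A0 + A1) ≤ 1 := (div_le_one hsum).2 hA
    have hpos : 0 < s / (A0 + A1) := by positivity
    have hid : s / (A0 + A1) * (A0 + A1) = s := by field_simp
    exact ⟨s / (A0 + A1) * A1, by positivity, by nlinarith, by nlinarith, by nlinarith⟩
  have hc : ENNReal.ofReal (1 / π) ^ (A - 1) ≠ ⊤ := rpow_ne_top_of_pos (by positivity)
  refine ⟨ENNReal.ofReal (1 / π) ^ (A - 1) * ∫⁻ t in Ioi (0:ℝ), ENNReal.ofReal |1 - t| ^ (-s) *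
    ENNReal.ofReal t ^ (A - 1), ENNReal.mul_ne_top hc (J_fin hA0 hAs hs).ne, fun x hx => ?_⟩
  calc _ ≤ ∫⁻ y in Ioo 0 π, ENNReal.ofReal (1 / π) ^ (A - 1) * (ENNReal.ofReal x ^ (s - A) *
        (ENNReal.ofReal |x - y| ^ (-s) * ENNReal.ofReal y ^ (A - 1))) := by
        refine setLIntegral_mono' measurableSet_Ioo fun y hy => ?_
        have b1 : ENNReal.ofReal (sin (x / 2)) ^ A0 ≤ ENNReal.ofReal x ^ (s - A) := by
          refine (ENNReal.rpow_le_rpow_of_exponent_ge (by simpa using sin_le_one _) hA2).trans ?_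
          refine ENNReal.rpow_le_rpow (ENNReal.ofReal_le_ofReal ?_) (by linarith)
          have := sin_le (x := x / 2) (by linarith [hx.1])
          linarith [hx.1]
        have b2 : ENNReal.ofReal (sin (y / 2)) ^ (A1 - 1) ≤
            ENNReal.ofReal (1 / π) ^ (A - 1) * ENNReal.ofReal y ^ (A - 1) := by
          refine (ENNReal.rpow_le_rpow_of_exponent_ge (by simpa using sin_le_one _)
            (z := A - 1) (by linarith)).trans ?_
          rw [← ENNReal.mul_rpow_of_ne_top ENNReal.ofReal_ne_top ENNReal.ofReal_ne_top,
            ← ENNReal.ofReal_mul (by positivity)]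
          refine rpow_anti (ENNReal.ofReal_le_ofReal ?_) (by linarith)
          have := mul_le_sin (x := y / 2) (by linarith [hy.1]) (by linarith [hy.2])
          calc _ = 2 / π * (y / 2) := by ring
            _ ≤ _ := this
        calc _ ≤ ENNReal.ofReal x ^ (s - A) * (ENNReal.ofReal |x - y| ^ (-s) *
            (ENNReal.ofReal (1 / π) ^ (A - 1) * ENNReal.ofReal y ^ (A - 1))) := by gcongr
          _ = _ := by ring
    _ = ENNReal.ofReal (1 / π) ^ (A - 1) * (ENNReal.ofReal x ^ (s - A) * ∫⁻ y in Ioo 0 π,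
        ENNReal.ofReal |x - y| ^ (-s) * ENNReal.ofReal y ^ (A - 1)) := by
        rw [lintegral_const_mul' _ _ hc, lintegral_const_mul' _ _ (rpow_ne_top_of_pos hx.1)]
    _ ≤ ENNReal.ofReal (1 / π) ^ (A - 1) * (ENNReal.ofReal x ^ (s - A) * ∫⁻ y in Ioi 0,
        ENNReal.ofReal |x - y| ^ (-s) * ENNReal.ofReal y ^ (A - 1)) := by
        gcongr
        exact Ioo_subset_Ioi_self
    _ = _ := by rw [J_scale hx.1]

theorem half_cos {A0 A1 s : ℝ} (h0 : 0 < A0) (h1 : 0 < A1) (hs0 : 0 < s) (hs : s < 1)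
    (hA : s ≤ A0 + A1) : ∃ C : ENNReal, C ≠ ⊤ ∧ ∀ x ∈ Ioo 0 π,
      ∫⁻ y in Ioo 0 π, ENNReal.ofReal (cos (x / 2)) ^ A0 * (ENNReal.ofReal |x - y| ^ (-s) *
        ENNReal.ofReal (cos (y / 2)) ^ (A1 - 1)) ≤ C := by
  obtain ⟨C, hC, H⟩ := half_sin h0 h1 hs0 hs hA
  refine ⟨C, hC, fun x hx => ?_⟩
  refine le_of_eq_of_le ?_ (H (π - x) ⟨by linarith [hx.2], by linarith [hx.1]⟩)
  rw [← lintegral_indicator measurableSet_Ioo, ← lintegral_indicator measurableSet_Ioo,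
    ← lintegral_sub_left_eq_self _ π]
  congr 1
  ext y
  by_cases hy : y ∈ Ioo 0 π
  · rw [indicator_of_mem hy, indicator_of_mem (by constructor <;> linarith [hy.1, hy.2])]
    rw [show (π - y) / 2 = π / 2 - y / 2 by ring, show (π - x) / 2 = π / 2 - x / 2 by ring,
      cos_pi_div_two_sub, sin_pi_div_two_sub, show x - (π - y) = -(π - x - y) by ring, abs_neg]
  · rw [indicator_of_notMem hy, indicator_of_notMem]
    intro h; exact hy ⟨by linarith [h.2], by linarith [h.1]⟩

theorem kernel_bound {A0 A1 B0 B1 s : ℝ} (h0 : 0 < A0) (h1 : 0 < A1) (k0 : 0 < B0) (k1 : 0 < B1)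
    (hs0 : 0 < s) (hs : s < 1) (hA : s ≤ A0 + A1) (hB : s ≤ B0 + B1) :
    ∃ C : ENNReal, C ≠ ⊤ ∧ ∀ x ∈ Ioo 0 π,
      ∫⁻ y in Ioo 0 π, (ENNReal.ofReal (sin (y / 2)) ^ (-1:ℝ) *
        ENNReal.ofReal (cos (y / 2)) ^ (-1:ℝ)) *
        ((ENNReal.ofReal (sin (x / 2)) ^ A0 * ENNReal.ofReal (cos (x / 2)) ^ B0) *
          ENNReal.ofReal |x - y| ^ (-s) *
        (ENNReal.ofReal (sin (y / 2)) ^ A1 * ENNReal.ofReal (cos (y / 2)) ^ B1)) ≤ C := by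
  obtain ⟨C, hC, H⟩ := half_sin h0 h1 hs0 hs hA
  obtain ⟨D, hD, K⟩ := half_cos k0 k1 hs0 hs hB
  refine ⟨C + D, ENNReal.add_ne_top.2 ⟨hC, hD⟩, fun x hx => ?_⟩
  refine le_trans ?_ (add_le_add (H x hx) (K x hx))
  rw [← lintegral_add_left (by fun_prop)]
  refine setLIntegral_mono' measurableSet_Ioo fun y hy => ?_
  have sp := sin_half_pos hy
  have cp := cos_half_pos hy
  have hone : ENNReal.ofReal (sin (y / 2)) ^ (-1:ℝ) * ENNReal.ofReal (cos (y / 2)) ^ (-1:ℝ) ≤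
      ENNReal.ofReal (sin (y / 2)) ^ (-1:ℝ) + ENNReal.ofReal (cos (y / 2)) ^ (-1:ℝ) := by
    rw [ENNReal.ofReal_rpow_of_pos sp, ENNReal.ofReal_rpow_of_pos cp,
      ← ENNReal.ofReal_mul (by positivity), ← ENNReal.ofReal_add (by positivity) (by positivity)]
    apply ENNReal.ofReal_le_ofReal
    rw [rpow_neg_one, rpow_neg_one, inv_add_inv sp.ne' cp.ne', ← mul_inv, inv_eq_one_div]
    gcongr
    nlinarith [sin_sq_add_cos_sq (y / 2), sin_le_one (y / 2), cos_le_one (y / 2)]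
  have le1 : ∀ (z e : ℝ), 0 < e → ENNReal.ofReal (sin z) ^ e ≤ 1 := fun z e he =>
    ENNReal.rpow_le_one (by simpa using sin_le_one _) he.le
  have le2 : ∀ (z e : ℝ), 0 < e → ENNReal.ofReal (cos z) ^ e ≤ 1 := fun z e he =>
    ENNReal.rpow_le_one (by simpa using cos_le_one _) he.le
  have r1 : ENNReal.ofReal (sin (y / 2)) ^ (-1:ℝ) * ENNReal.ofReal (sin (y / 2)) ^ A1 =
      ENNReal.ofReal (sin (y / 2)) ^ (A1 - 1) := by
    rw [← ENNReal.rpow_add _ _ (by simpa using sp) ENNReal.ofReal_ne_top]; congr 1; ring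
  have r2 : ENNReal.ofReal (cos (y / 2)) ^ (-1:ℝ) * ENNReal.ofReal (cos (y / 2)) ^ B1 =
      ENNReal.ofReal (cos (y / 2)) ^ (B1 - 1) := by
    rw [← ENNReal.rpow_add _ _ (by simpa using cp) ENNReal.ofReal_ne_top]; congr 1; ring
  have m1 := le1 (x / 2) A0 h0
  have m2 := le2 (x / 2) B0 k0
  have m3 := le1 (y / 2) A1 h1
  have m4 := le2 (y / 2) B1 k1
  rw [← r1, ← r2]
  generalize ENNReal.ofReal (sin (x / 2)) ^ A0 = a at *
  generalize ENNReal.ofReal (cos (x / 2)) ^ B0 = b at *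
  generalize ENNReal.ofReal (sin (y / 2)) ^ A1 = c at *
  generalize ENNReal.ofReal (cos (y / 2)) ^ B1 = d at *
  generalize ENNReal.ofReal (sin (y / 2)) ^ (-1:ℝ) = u at *
  generalize ENNReal.ofReal (cos (y / 2)) ^ (-1:ℝ) = v at *
  generalize ENNReal.ofReal |x - y| ^ (-s) = w at *
  calc _ ≤ (u + v) * (a * b * w * (c * d)) := by gcongr
    _ = (a * (w * (u * c))) * (b * d) + (b * (w * (v * d))) * (a * c) := by ring
    _ ≤ (a * (w * (u * c))) * (1 * 1) + (b * (w * (v * d))) * (1 * 1) := by gcongr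
    _ = _ := by ring

theorem exps {σ α p q : ℝ} (hσ0 : 0 < σ) (hα : -(1/2) ≤ α) (hp : (2*α+2)/(α+3/2) < p)
    (hpq : p ≤ q) (hq : q < (2*α+2)/(α+1/2)) (h : 1/p - 1/q ≤ σ/(2*α+2)) :
    1 < p ∧ 0 < ((2*α+1)*(1-q/2)+1)/q ∧ 0 < 1 - ((2*α+1)*(1-p/2)+1)/p ∧
    1 - σ ≤ ((2*α+1)*(1-q/2)+1)/q + (1 - ((2*α+1)*(1-p/2)+1)/p) ∧ 1/p - 1/q < σ := by
  rw [div_lt_iff₀ (by linarith)] at hp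
  have hp1 : 1 < p := by nlinarith
  have hq0 : 0 < q := by linarith
  have hα' : 0 < α + 1/2 := by
    rcases hα.lt_or_eq with h | h
    · linarith
    · exfalso; rw [← h] at hq; norm_num at hq; linarith
  rw [lt_div_iff₀ hα'] at hq
  rw [le_div_iff₀ (by linarith)] at h
  have hp0 : 0 < p := by linarith
  refine ⟨hp1, div_pos (by nlinarith) hq0, ?_, ?_, ?_⟩
  · rw [sub_pos, div_lt_one hp0]; nlinarith
  · have : ((2*α+1)*(1-q/2)+1)/q + (1 - ((2*α+1)*(1-p/2)+1)/p) =
      1 - (1/p - 1/q) * (2*α+2) := by field_simp; ring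
    rw [this]; linarith
  · rcases le_or_gt (1/p - 1/q) 0 with h0 | h0
    · linarith
    · nlinarith

theorem fracIntegral_weighted_Lp_Lq (σ α β p q : ℝ) (hσ0 : 0 < σ) (hσ1 : σ < 1)
    (hα : -(1/2) ≤ α) (hβ : -(1/2) ≤ β)
    (hp : max ((2*α+2)/(α+3/2)) ((2*β+2)/(β+3/2)) < p) (hpq : p ≤ q)
    (hq : q < min ((2*α+2)/(α+1/2)) ((2*β+2)/(β+1/2)))
    (hσpq : 1/q ≥ 1/p - min (σ/(2*α+2)) (σ/(2*β+2))) :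
    ∃ C : ℝ, 0 < C ∧ ∀ g : ℝ → ℝ, Measurable g → (∀ θ, 0 ≤ g θ) →
      (∫⁻ θ in Ioo (0:ℝ) π, fracIntegral σ g θ ^ q *
          ENNReal.ofReal ((Real.sin (θ/2)) ^ ((2*α+1)*(1 - q/2)) *
            (Real.cos (θ/2)) ^ ((2*β+1)*(1 - q/2)))) ^ (1/q) ≤
        ENNReal.ofReal C *
          (∫⁻ θ in Ioo (0:ℝ) π, ENNReal.ofReal (g θ) ^ p *
            ENNReal.ofReal ((Real.sin (θ/2)) ^ ((2*α+1)*(1 - p/2)) *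
              (Real.cos (θ/2)) ^ ((2*β+1)*(1 - p/2)))) ^ (1/p) := by
  have hm1 := min_le_left (σ/(2*α+2)) (σ/(2*β+2))
  have hm2 := min_le_right (σ/(2*α+2)) (σ/(2*β+2))
  obtain ⟨hp1, hA0, hA1, hA, hlt⟩ := exps hσ0 hα ((le_max_left _ _).trans_lt hp) hpq
    (hq.trans_le (min_le_left _ _)) (by linarith)
  obtain ⟨-, hB0, hB1, hB, -⟩ := exps hσ0 hβ ((le_max_right _ _).trans_lt hp) hpq
    (hq.trans_le (min_le_right _ _)) (by linarith)
  have hp0 : 0 < p := by linarith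
  have hq0 : 0 < q := by linarith
  set a := (2*α+1)*(1-q/2) with ha
  set b := (2*β+1)*(1-q/2) with hb
  set c := (2*α+1)*(1-p/2) with hc
  set d := (2*β+1)*(1-p/2) with hd
  clear_value a b c d
  have hr1 : 0 < 1 - 1/p + 1/q := by linarith
  obtain ⟨r, hr⟩ : ∃ r : ℝ, r = (1 - 1/p + 1/q)⁻¹ := ⟨_, rfl⟩
  have hr0 : 0 < r := by rw [hr]; positivity
  have hrr : 1 / r = 1 - 1/p + 1/q := by rw [hr]; simp
  have hs0 : 0 < (1 - σ) * r := mul_pos (by linarith) hr0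
  have hs1 : (1 - σ) * r < 1 := by
    rw [← lt_div_iff₀ hr0, hrr]; linarith
  have hA' : (1 - σ) * r ≤ (a + 1)/q * r + (1 - (c+1)/p) * r := by
    rw [← add_mul]; gcongr
  have hB' : (1 - σ) * r ≤ (b + 1)/q * r + (1 - (d+1)/p) * r := by
    rw [← add_mul]; gcongr
  obtain ⟨C, hC, H⟩ := kernel_bound (mul_pos hA0 hr0) (mul_pos hA1 hr0) (mul_pos hB0 hr0)
    (mul_pos hB1 hr0) hs0 hs1 hA' hB'
  obtain ⟨D, hD, K⟩ := kernel_bound (mul_pos hA1 hr0) (mul_pos hA0 hr0) (mul_pos hB1 hr0)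
    (mul_pos hB0 hr0) hs0 hs1 (by linarith) (by linarith)
  have hM : (max C D) ^ (1 / r) ≠ ⊤ :=
    ENNReal.rpow_ne_top_of_nonneg (by positivity) (max_lt hC.lt_top hD.lt_top).ne
  refine ⟨((max C D) ^ (1 / r)).toReal + 1, by positivity, fun g hg _ => ?_⟩
  have hfin : (max C D) ^ (1 / r) ≤ ENNReal.ofReal (((max C D) ^ (1 / r)).toReal + 1) := by
    conv_lhs => rw [← ENNReal.ofReal_toReal hM]
    exact ENNReal.ofReal_le_ofReal (by linarith)
  set S : ℝ → ENNReal := fun x => ENNReal.ofReal (sin (x / 2)) with hS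
  set T : ℝ → ENNReal := fun x => ENNReal.ofReal (cos (x / 2)) with hT
  have mS : Measurable S := by fun_prop
  have mT : Measurable T := by fun_prop
  set ρ : ℝ → ENNReal := fun y => S y ^ (-1:ℝ) * T y ^ (-1:ℝ) with hρ
  have mρ : Measurable ρ := by fun_prop
  set k : ℝ → ℝ → ENNReal := fun x y => (S x ^ ((a+1)/q) * T x ^ ((b+1)/q)) *
    ENNReal.ofReal |x - y| ^ (σ - 1) * (S y ^ (1 - (c+1)/p) * T y ^ (1 - (d+1)/p)) with hk
  have mk : Measurable (Function.uncurry k) := by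
    simp only [hk, Function.uncurry_def]
    fun_prop
  set f : ℝ → ENNReal := fun y => ENNReal.ofReal (g y) * (S y ^ ((c+1)/p) * T y ^ ((d+1)/p))
    with hf
  have mf : Measurable f := by fun_prop
  set μ₀ : Measure ℝ := volume.restrict (Ioo 0 π) with hμ₀
  have hkr : ∀ x y, k x y ^ r = (S x ^ ((a+1)/q * r) * T x ^ ((b+1)/q * r)) *
      ENNReal.ofReal |x - y| ^ (-((1 - σ) * r)) *
      (S y ^ ((1 - (c+1)/p) * r) * T y ^ ((1 - (d+1)/p) * r)) := by
    intro x y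
    simp only [hk, ENNReal.mul_rpow_of_nonneg _ _ hr0.le, ← ENNReal.rpow_mul]
    rw [show -((1 - σ) * r) = (σ - 1) * r by ring]
  have ae : ∀ {P : ℝ → Prop}, (∀ x ∈ Ioo 0 π, P x) → ∀ᵐ x ∂(μ₀.withDensity ρ), P x := by
    intro P hP
    exact (withDensity_absolutelyContinuous _ _).ae_le
      ((ae_restrict_iff' measurableSet_Ioo).2 (Filter.Eventually.of_forall hP))
  have main := schur_young (μ := μ₀.withDensity ρ) k mk f mf p q r hp1 hpq hr0 hrr (max C D)
    (ae fun x hx => by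
      rw [lintegral_withDensity_eq_lintegral_mul _ mρ (mk.of_uncurry_left.pow_const _)]
      refine le_trans (le_of_eq ?_) ((H x hx).trans (le_max_left _ _))
      simp only [Pi.mul_apply, hkr, hρ, hS, hT])
    (ae fun y hy => by
      rw [lintegral_withDensity_eq_lintegral_mul _ mρ (mk.of_uncurry_right.pow_const _)]
      refine le_trans (le_of_eq ?_) ((K y hy).trans (le_max_right _ _))
      refine lintegral_congr fun x => ?_
      simp only [Pi.mul_apply, hkr, hρ, hS, hT]
      rw [abs_sub_comm x y]
      ring)
  have fin : ∀ {x}, x ∈ Ioo 0 π → S x ≠ 0 ∧ S x ≠ ⊤ ∧ T x ≠ 0 ∧ T x ≠ ⊤ := fun {x} hx =>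
    ⟨by simpa [hS] using sin_half_pos hx, ENNReal.ofReal_ne_top,
      by simpa [hT] using cos_half_pos hx, ENNReal.ofReal_ne_top⟩
  have hwt : ∀ {x}, x ∈ Ioo 0 π → ∀ u v : ℝ,
      ENNReal.ofReal (sin (x / 2) ^ u * cos (x / 2) ^ v) = S x ^ u * T x ^ v := by
    intro x hx u v
    have h1 := sin_half_pos hx
    have h2 := cos_half_pos hx
    rw [ENNReal.ofReal_mul (by positivity), ← ENNReal.ofReal_rpow_of_pos h1,
      ← ENNReal.ofReal_rpow_of_pos h2]
  have R : ∫⁻ y, f y ^ p ∂(μ₀.withDensity ρ) = ∫⁻ θ in Ioo (0:ℝ) π, ENNReal.ofReal (g θ) ^ p *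
      ENNReal.ofReal (sin (θ/2) ^ c * cos (θ/2) ^ d) := by
    rw [lintegral_withDensity_eq_lintegral_mul _ mρ (mf.pow_const _)]
    refine setLIntegral_congr_fun measurableSet_Ioo fun y hy => ?_
    obtain ⟨s0, s1, t0, t1⟩ := fin hy
    simp only [Pi.mul_apply, hρ, hf, hwt hy]
    simp only [ENNReal.mul_rpow_of_nonneg _ _ hp0.le, ← ENNReal.rpow_mul,
      div_mul_cancel₀ _ hp0.ne']
    rw [ENNReal.rpow_add c 1 s0 s1, ENNReal.rpow_add d 1 t0 t1, ENNReal.rpow_neg,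
      ENNReal.rpow_neg, ENNReal.rpow_one, ENNReal.rpow_one]
    calc _ = (S y * (S y)⁻¹) * (T y * (T y)⁻¹) *
        (ENNReal.ofReal (g y) ^ p * (S y ^ c * T y ^ d)) := by ring
      _ = _ := by rw [ENNReal.mul_inv_cancel s0 s1, ENNReal.mul_inv_cancel t0 t1]; ring
  have L0 : ∀ x ∈ Ioo 0 π, ∫⁻ y, k x y * f y ∂(μ₀.withDensity ρ) =
      (S x ^ ((a+1)/q) * T x ^ ((b+1)/q)) * fracIntegral σ g x := by
    intro x hx
    obtain ⟨s0, s1, t0, t1⟩ := fin hx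
    have mkf : Measurable fun y => k x y * f y := mk.of_uncurry_left.mul mf
    rw [lintegral_withDensity_eq_lintegral_mul _ mρ mkf, fracIntegral,
      ← lintegral_const_mul _ (by fun_prop)]
    refine setLIntegral_congr_fun measurableSet_Ioo fun y hy => ?_
    obtain ⟨s0, s1, t0, t1⟩ := fin hy
    simp only [Pi.mul_apply, hρ, hf, hk]
    have e1 : S y ^ (-1:ℝ) * S y ^ (1 - (c+1)/p) * S y ^ ((c+1)/p) = 1 := by
      rw [← ENNReal.rpow_add _ _ s0 s1, ← ENNReal.rpow_add _ _ s0 s1]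
      convert ENNReal.rpow_zero using 2; ring
    have e2 : T y ^ (-1:ℝ) * T y ^ (1 - (d+1)/p) * T y ^ ((d+1)/p) = 1 := by
      rw [← ENNReal.rpow_add _ _ t0 t1, ← ENNReal.rpow_add _ _ t0 t1]
      convert ENNReal.rpow_zero using 2; ring
    calc _ = (S y ^ (-1:ℝ) * S y ^ (1 - (c+1)/p) * S y ^ ((c+1)/p)) *
          (T y ^ (-1:ℝ) * T y ^ (1 - (d+1)/p) * T y ^ ((d+1)/p)) *
          ((S x ^ ((a+1)/q) * T x ^ ((b+1)/q)) *
            (ENNReal.ofReal (g y) * ENNReal.ofReal |x - y| ^ (σ - 1))) := by ring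
      _ = _ := by rw [e1, e2]; ring
  have mL : Measurable fun x => (∫⁻ y, k x y * f y ∂(μ₀.withDensity ρ)) ^ q := by
    have : Measurable (Function.uncurry fun x y => k x y * f y) :=
      mk.mul (mf.comp measurable_snd)
    exact (this.lintegral_prod_right').pow_const q
  have L : ∫⁻ x, (∫⁻ y, k x y * f y ∂(μ₀.withDensity ρ)) ^ q ∂(μ₀.withDensity ρ) =
      ∫⁻ θ in Ioo (0:ℝ) π, fracIntegral σ g θ ^ q *
        ENNReal.ofReal (sin (θ/2) ^ a * cos (θ/2) ^ b) := by
    rw [lintegral_withDensity_eq_lintegral_mul _ mρ mL]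
    refine setLIntegral_congr_fun measurableSet_Ioo fun x hx => ?_
    obtain ⟨s0, s1, t0, t1⟩ := fin hx
    simp only [Pi.mul_apply, hwt hx, L0 x hx]
    simp only [hρ]
    simp only [ENNReal.mul_rpow_of_nonneg _ _ hq0.le, ← ENNReal.rpow_mul,
      div_mul_cancel₀ _ hq0.ne']
    rw [ENNReal.rpow_add a 1 s0 s1, ENNReal.rpow_add b 1 t0 t1, ENNReal.rpow_neg,
      ENNReal.rpow_neg, ENNReal.rpow_one, ENNReal.rpow_one]
    calc _ = (S x * (S x)⁻¹) * (T x * (T x)⁻¹) *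
        (fracIntegral σ g x ^ q * (S x ^ a * T x ^ b)) := by ring
      _ = _ := by rw [ENNReal.mul_inv_cancel s0 s1, ENNReal.mul_inv_cancel t0 t1]; ring
  rw [L, R] at main
  exact main.trans (by gcongr)
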